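/- arXiv:2110.09387 — 3 statements merged into one kernel-verified Lean document; each statement's English description precedes it below -/
import Mathlib

section
/- Let (T, m_T) be a discrete valuation ring with residue field L of characteristic 2, and let k′ ⊆ L be a subfield such that L/k′ is a purely inseparable field extension of degree 2. Let R ⊆ T be the preimage of k′ under the residue map T → L. Then: (1) R is a local ring with maximal ideal m_T and residue field k′; (2) for any u ∈ T whose residue class generates L over k′ one has T = R + R·u, so T is a finitely generated R-module; (3) R is a Noetherian ring; and (4) T is the integral closure of R in the fraction field of T (which equals the fraction field of R). -/
open IsLocalRing

section Helpers

variable {T : Type*} [CommRing T] [IsDomain T] [IsDiscreteValuationRing T]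
  {k' : Subfield (ResidueField T)}

lemma aux_mem_of_max (R : Subring T) (hR : ∀ x, x ∈ R ↔ residue T x ∈ k') (x : T)
    (hx : x ∈ maximalIdeal T) : x ∈ R := by
  rw [hR, (residue_eq_zero_iff x).2 hx]
  exact k'.zero_mem

lemma aux_localHom (R : Subring T) (hR : ∀ x, x ∈ R ↔ residue T x ∈ k') :
    IsLocalHom R.subtype := by
  constructor
  intro a ha
  obtain ⟨b, hb⟩ := ha.exists_right_inv
  have h1 : residue T a * residue T b = 1 := by rw [← map_mul]; simpa using congrArg (residue T) hb
  have hbR : b ∈ R := by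
    rw [hR, eq_inv_of_mul_eq_one_right h1]
    exact k'.inv_mem ((hR _).1 a.2)
  exact IsUnit.of_mul_eq_one (⟨b, hbR⟩ : R) (Subtype.ext hb)

lemma aux_isLocal (R : Subring T) (hR : ∀ x, x ∈ R ↔ residue T x ∈ k') : IsLocalRing R := by
  haveI := aux_localHom R hR
  exact RingHom.domain_isLocalRing R.subtype

lemma aux_mem_max (R : Subring T) (hR : ∀ x, x ∈ R ↔ residue T x ∈ k') [IsLocalRing R] (x : R) :
    x ∈ maximalIdeal R ↔ (x : T) ∈ maximalIdeal T := by
  haveI := aux_localHom R hR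
  rw [mem_maximalIdeal, mem_maximalIdeal, mem_nonunits_iff, mem_nonunits_iff, not_iff_not]
  exact (isUnit_map_iff R.subtype x).symm

lemma aux_decomp (hdeg : Module.finrank k' (ResidueField T) = 2)
    (R : Subring T) (hR : ∀ x, x ∈ R ↔ residue T x ∈ k')
    (u : T) (hu : residue T u ∉ k') (x : T) : ∃ r s : R, x = (r : T) + (s : T) * u := by
  have hli : LinearIndependent k' ![(1 : ResidueField T), residue T u] := by
    rw [LinearIndependent.pair_iff' one_ne_zero]
    intro a ha
    apply hu
    rw [← ha, Subfield.smul_def, smul_eq_mul, mul_one]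
    exact a.2
  have : FiniteDimensional k' (ResidueField T) := .of_finrank_pos (by omega)
  have hs := hli.span_eq_top_of_card_eq_finrank' (by simp [hdeg])
  have hx : residue T x ∈ Submodule.span k' (Set.range ![(1 : ResidueField T), residue T u]) := by
    rw [hs]; trivial
  rw [Matrix.range_cons, Matrix.range_cons, Matrix.range_empty, Set.union_empty,
    Set.singleton_union, Submodule.mem_span_pair] at hx
  obtain ⟨a, b, hab⟩ := hx
  obtain ⟨r, hr⟩ := residue_surjective (R := T) a
  obtain ⟨s, hs⟩ := residue_surjective (R := T) b
  have hsR : s ∈ R := by rw [hR, hs]; exact b.2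
  have hrR : x - s * u ∈ R := by
    rw [hR, map_sub, map_mul, hs, ← hab]
    simp [Subfield.smul_def]
  exact ⟨⟨_, hrR⟩, ⟨s, hsR⟩, by simp⟩

lemma aux_notMem (hdeg : Module.finrank k' (ResidueField T) = 2) (a : ResidueField T)
    (h : IntermediateField.adjoin k' ({a} : Set (ResidueField T)) = ⊤) : a ∉ k' := by
  intro ha
  have h1 : IntermediateField.adjoin k' ({a} : Set (ResidueField T)) = ⊥ := by
    rw [IntermediateField.adjoin_simple_eq_bot_iff, IntermediateField.mem_bot]
    exact ⟨⟨a, ha⟩, rfl⟩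
  rw [h] at h1
  have h2 := IntermediateField.finrank_top' (F := k') (E := ResidueField T)
  rw [h1, IntermediateField.finrank_bot, hdeg] at h2
  omega

lemma aux_exists (hdeg : Module.finrank k' (ResidueField T) = 2) :
    ∃ u : T, residue T u ∉ k' := by
  by_contra! h
  have h1 : Module.finrank k' (ResidueField T) = 1 := by
    rw [finrank_eq_one_iff_of_nonzero' (1 : ResidueField T) one_ne_zero]
    intro w
    obtain ⟨t, rfl⟩ := residue_surjective (R := T) w
    exact ⟨⟨_, h t⟩, by simp [Subfield.smul_def]⟩
  omega

lemma aux_finite (hdeg : Module.finrank k' (ResidueField T) = 2)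
    (R : Subring T) (hR : ∀ x, x ∈ R ↔ residue T x ∈ k') : Module.Finite R T := by
  obtain ⟨u, hu⟩ := aux_exists hdeg
  refine ⟨Submodule.fg_def.2 ⟨{1, u}, by simp, ?_⟩⟩
  rw [eq_top_iff]
  intro x _
  obtain ⟨r, s, rfl⟩ := aux_decomp hdeg R hR u hu x
  rw [Submodule.mem_span_pair]
  exact ⟨r, s, by simp [Subring.smul_def]⟩

lemma aux_noeth (hdeg : Module.finrank k' (ResidueField T) = 2)
    (R : Subring T) (hR : ∀ x, x ∈ R ↔ residue T x ∈ k') : IsNoetherianRing R := by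
  haveI := aux_isLocal R hR
  obtain ⟨u, hu⟩ := aux_exists hdeg
  obtain ⟨p, hp⟩ := IsDiscreteValuationRing.exists_irreducible T
  have hpm : ∀ t, p * t ∈ maximalIdeal T := fun t => by
    rw [hp.maximalIdeal_eq]; exact Ideal.mul_mem_right _ _ (Ideal.mem_span_singleton_self p)
  have hpR : ∀ t, p * t ∈ R := fun t => aux_mem_of_max R hR _ (hpm t)
  have hdvd : ∀ y : R, y ∈ maximalIdeal R → ∃ t, (y : T) = p * t := fun y hy => by
    rw [aux_mem_max R hR, hp.maximalIdeal_eq, Ideal.mem_span_singleton] at hy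
    exact hy
  apply IsNoetherianRing.of_prime
  intro P hP
  by_cases hP0 : P = ⊥
  · rw [hP0]; exact Submodule.fg_bot
  have hPm : P = maximalIdeal R := by
    apply le_antisymm (le_maximalIdeal hP.ne_top)
    intro y hy
    obtain ⟨x, hx, hx0⟩ := Submodule.exists_mem_ne_zero_of_ne_bot hP0
    have hx0' : (x : T) ≠ 0 := fun h => hx0 (Subtype.ext h)
    obtain ⟨n, v, hv⟩ := IsDiscreteValuationRing.eq_unit_mul_pow_irreducible hx0' hp
    obtain ⟨t, ht⟩ := hdvd y hy
    apply hP.mem_of_pow_mem (n + 1)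
    have : y ^ (n + 1) = ⟨p * (↑v⁻¹ * t ^ (n + 1)), hpR _⟩ * x := by
      apply Subtype.ext
      push_cast
      rw [ht, hv]
      have : (↑v⁻¹ : T) * v = 1 := v.inv_mul
      linear_combination (-(p ^ (n+1) * t ^ (n+1))) * this
    rw [this]
    exact P.mul_mem_left _ hx
  rw [hPm]
  refine Submodule.fg_def.2 ⟨{⟨p * 1, hpR 1⟩, ⟨p * u, hpR u⟩}, by simp, ?_⟩
  apply le_antisymm
  · rw [Submodule.span_le]
    rintro z (rfl | rfl)
    · exact (aux_mem_max R hR _).2 (hpm _)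
    · exact (aux_mem_max R hR _).2 (hpm _)
  · intro y hy
    obtain ⟨t, ht⟩ := hdvd y hy
    obtain ⟨r, s, rfl⟩ := aux_decomp hdeg R hR u hu t
    rw [Submodule.mem_span_pair]
    refine ⟨r, s, Subtype.ext ?_⟩
    rw [ht]
    simp only [smul_eq_mul, Subring.coe_add, Subring.coe_mul]
    ring

lemma aux_integral (R : Subring T) (hR : ∀ x, x ∈ R ↔ residue T x ∈ k')
    (hins : ∀ a : ResidueField T, a ^ 2 ∈ k') {K : Type*} [Field K] [Algebra T K] [IsFractionRing T K] [Algebra R K]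
    [IsScalarTower R T K] (y : K) :
    IsIntegral R y ↔ ∃ t : T, algebraMap T K t = y := by
  constructor
  · intro h
    exact IsIntegrallyClosed.isIntegral_iff.1 (h.tower_top (A := T))
  · rintro ⟨t, rfl⟩
    have : IsIntegral R (t ^ 2) := by
      have h : t ^ 2 ∈ R := by rw [hR, map_pow]; exact hins _
      exact isIntegral_algebraMap (R := R) (A := T) (x := ⟨t ^ 2, h⟩)
    exact (this.of_pow two_pos).algebraMap

lemma aux_frac (R : Subring T) (hR : ∀ x, x ∈ R ↔ residue T x ∈ k')
    {K : Type*} [Field K] [Algebra T K] [IsFractionRing T K] [Algebra R K]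
    [IsScalarTower R T K] : IsFractionRing R K := by
  obtain ⟨p, hp⟩ := IsDiscreteValuationRing.exists_irreducible T
  have hpR : ∀ t, p * t ∈ R := fun t => aux_mem_of_max R hR _ (by
    rw [hp.maximalIdeal_eq]; exact Ideal.mul_mem_right _ _ (Ideal.mem_span_singleton_self p))
  have hinj : Function.Injective (algebraMap R K) := by
    rw [IsScalarTower.algebraMap_eq R T K]
    exact (IsFractionRing.injective T K).comp Subtype.val_injective
  haveI : FaithfulSMul R K := (faithfulSMul_iff_algebraMap_injective _ _).2 hinj
  apply IsFractionRing.of_field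
  intro z
  obtain ⟨a, b, hb, rfl⟩ := IsFractionRing.div_surjective (A := T) z
  refine ⟨⟨p * a, hpR a⟩, ⟨p * b, hpR b⟩, ?_⟩
  rw [IsScalarTower.algebraMap_apply R T K,
    IsScalarTower.algebraMap_apply R T K]
  change _ = algebraMap T _ (p * a) / algebraMap T _ (p * b)
  rw [map_mul, map_mul, mul_div_mul_left]
  simpa using hp.ne_zero

end Helpers

set_option synthInstance.maxHeartbeats 2000000 in
set_option maxHeartbeats 4000000 in
/-- Let `(T, m_T)` be a discrete valuation ring whose residue field `L` has
characteristic 2, and let `k′ ⊆ L` be a subfield such that `L/k′` is purely inseparable of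
degree 2 (`[L : k′] = 2` and `a² ∈ k′` for all `a ∈ L`).  Let `R ⊆ T` be the preimage of `k′`
under the residue map `T → L`.  Then:
(1) `R` is a local ring with maximal ideal `m_T` and residue field `k′` (the corestricted
residue map `R → k′` is surjective with kernel the maximal ideal of `R`);
(2) for any `u ∈ T` whose residue class generates `L` over `k′` one has `T = R + R·u`, and `T`
is a finitely generated `R`-module;
(3) `R` is Noetherian;
(4) `T` is the integral closure of `R` in `Frac T`, which is also the fraction field of `R`. -/
theorem preimage_of_inseparable_subfield_is_inseparable_node
    (T : Type*) [CommRing T] [IsDomain T] [IsDiscreteValuationRing T]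
    [CharP (ResidueField T) 2]
    (k' : Subfield (ResidueField T))
    (hdeg : Module.finrank k' (ResidueField T) = 2)
    (hins : ∀ a : ResidueField T, a ^ 2 ∈ k') :
    letI R : Subring T := (k'.toSubring).comap (IsLocalRing.residue T)
    letI resk' : R →+* k' :=
      RingHom.codRestrict ((IsLocalRing.residue T).comp R.subtype) k'.toSubring
        (fun x => x.2)
    letI : Algebra R (FractionRing T) :=
      ((algebraMap T (FractionRing T)).comp R.subtype).toAlgebra
    (∃ _ : IsLocalRing R,
        (∀ x : R, x ∈ IsLocalRing.maximalIdeal R ↔ (x : T) ∈ IsLocalRing.maximalIdeal T) ∧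
        Function.Surjective resk' ∧
        RingHom.ker resk' = IsLocalRing.maximalIdeal R) ∧
    (∀ u : T, IntermediateField.adjoin k' ({IsLocalRing.residue T u} : Set (ResidueField T)) = ⊤ →
        ∀ x : T, ∃ r s : R, x = (r : T) + (s : T) * u) ∧
    Module.Finite R T ∧
    IsNoetherianRing R ∧
    (∀ y : FractionRing T, IsIntegral R y ↔ ∃ t : T, algebraMap T (FractionRing T) t = y) ∧
    IsFractionRing R (FractionRing T) := by
  have hR : ∀ x, x ∈ (k'.toSubring).comap (IsLocalRing.residue T) ↔ residue T x ∈ k' :=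
    fun x => Iff.rfl
  letI alg : Algebra ((k'.toSubring).comap (IsLocalRing.residue T)) (FractionRing T) :=
      ((algebraMap T (FractionRing T)).comp
        ((k'.toSubring).comap (IsLocalRing.residue T)).subtype).toAlgebra
  refine ⟨⟨aux_isLocal _ hR, ?_, ?_, ?_⟩, ?_, aux_finite hdeg _ hR, aux_noeth hdeg _ hR,
    ?_, ?_⟩
  · letI := aux_isLocal _ hR
    exact aux_mem_max _ hR
  · intro a
    obtain ⟨t, ht⟩ := residue_surjective (R := T) a
    exact ⟨⟨t, (hR t).2 (ht ▸ a.2)⟩, Subtype.ext ht⟩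
  · letI := aux_isLocal _ hR
    ext x
    rw [RingHom.mem_ker, aux_mem_max _ hR, ← residue_eq_zero_iff]
    exact Subtype.ext_iff
  · intro u hu
    exact aux_decomp hdeg _ hR u (aux_notMem hdeg _ hu)
  · exact @aux_integral T _ _ _ k' _ hR hins (FractionRing T) _ _ _ alg
      (@IsScalarTower.of_algebraMap_eq _ T (FractionRing T) _ _ _ _ _ alg fun _ => rfl)
  · exact @aux_frac T _ _ _ k' _ hR (FractionRing T) _ _ _ alg
      (@IsScalarTower.of_algebraMap_eq _ T (FractionRing T) _ _ _ _ _ alg fun _ => rfl)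
end

section
/- Let K be a field of characteristic different from 2 and let τ be a ring automorphism of the formal power series ring K[[X]] such that τ ∘ τ = id, τ is not the identity, and τ maps the subring of constant power series onto itself. Then there exists a power series s ∈ K[[X]] lying in the ideal (X) but not in (X)² (i.e. of X-adic order exactly 1) such that τ(s) = −s. -/
open PowerSeries

/-- Let `K` be a field of characteristic `≠ 2` and let `τ` be a ring
automorphism of `K[[X]]` which is an involution (`τ ∘ τ = id`), is not the identity, and maps
the subring of constant power series onto itself.  Then there is a power series `s` lying in
the ideal `(X)` but not in `(X)²` (i.e. a uniformizer) such that `τ s = -s`. -/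
theorem exists_uniformizer_neg_of_involution_powerSeries
    (K : Type*) [Field K] (hK : ringChar K ≠ 2)
    (τ : PowerSeries K ≃+* PowerSeries K)
    (hinv : ∀ f : PowerSeries K, τ (τ f) = f)
    (hne : τ ≠ RingEquiv.refl (PowerSeries K))
    (hconst : Subring.map (τ : PowerSeries K →+* PowerSeries K) (PowerSeries.C (R := K)).range
      = (PowerSeries.C (R := K)).range) :
    ∃ s : PowerSeries K,
      s ∈ Ideal.span {(PowerSeries.X : PowerSeries K)} ∧
      s ∉ (Ideal.span {(PowerSeries.X : PowerSeries K)}) ^ 2 ∧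
      τ s = -s := by
  have hX0 : constantCoeff (τ X) = 0 := by
    by_contra h
    have h1 : IsUnit (τ (X : PowerSeries K)) :=
      PowerSeries.isUnit_iff_constantCoeff.mpr (isUnit_iff_ne_zero.mpr h)
    have h2 : IsUnit (X : PowerSeries K) := by
      have := h1.map τ
      rwa [hinv] at this
    have h3 := PowerSeries.isUnit_iff_constantCoeff.mp h2
    simp at h3
  obtain ⟨u, hu⟩ := PowerSeries.X_dvd_iff.mpr hX0
  by_contra hcon
  push Not at hcon
  have key : ∀ g : PowerSeries K,
      constantCoeff g = constantCoeff u * constantCoeff (τ g) := by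
    intro g
    have e : X * g - τ (X * g) = X * (g - u * τ g) := by
      rw [map_mul, hu]; ring
    by_contra hg
    refine hcon (X * g - τ (X * g)) ?_ ?_ ?_
    · rw [e]
      exact Ideal.mem_span_singleton.mpr (dvd_mul_right _ _)
    · rw [e, Ideal.span_singleton_pow, Ideal.mem_span_singleton, pow_two,
        mul_dvd_mul_iff_left PowerSeries.X_ne_zero, PowerSeries.X_dvd_iff, map_sub, map_mul,
        sub_eq_zero]
      exact hg
    · rw [map_sub, hinv]; ring
  have hu1 : constantCoeff u = 1 := by
    have := key 1
    simpa using this.symm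
  apply hne
  ext1 f
  by_contra hf
  have hd : f - τ f ≠ 0 := fun h => hf (sub_eq_zero.mp h).symm
  have hτd : τ (f - τ f) = -(f - τ f) := by rw [map_sub, hinv]; ring
  generalize f - τ f = d at hd hτd
  obtain ⟨n, g, hg, rfl⟩ : ∃ (n : ℕ) (g : PowerSeries K), constantCoeff g ≠ 0 ∧ d = X ^ n * g := by
    obtain ⟨g, h1, h2⟩ := (FiniteMultiplicity.of_prime_left PowerSeries.X_prime hd).exists_eq_pow_mul_and_not_dvd
    exact ⟨_, g, fun h => h2 (PowerSeries.X_dvd_iff.mpr h), h1⟩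
  rw [map_mul, map_pow, hu, mul_pow, mul_assoc, ← mul_neg] at hτd
  have h4 := mul_left_cancel₀ (pow_ne_zero n PowerSeries.X_ne_zero) hτd
  have h5 := congrArg constantCoeff h4
  have h6 := key g
  rw [map_mul, map_pow, hu1, one_pow, one_mul, map_neg] at h5
  rw [hu1, one_mul, h5] at h6
  have h2 : (2 : K) ≠ 0 := Ring.two_ne_zero hK
  apply hg
  have h7 : (2 : K) * constantCoeff g = 0 := by linear_combination h6
  exact (mul_eq_zero.mp h7).resolve_left h2
end

section
/- Let k be a field and let Y be a scheme that is proper over Spec k (the structure morphism is separated, of finite type, and universally closed), reduced, and connected. Then the ring of global sections H⁰(Y, O_Y) is a field and is a finite-dimensional k-vector space; that is, H⁰(Y, O_Y) is a finite field extension of k. -/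
open AlgebraicGeometry CategoryTheory

universe u

lemma aux_idem (Y : Scheme.{u}) [ConnectedSpace Y] (e : Γ(Y, ⊤)) (he : e * e = e) :
    e = 0 ∨ e = 1 := by
  have hsup : Y.basicOpen e ⊔ Y.basicOpen (1 - e) = ⊤ := by
    rw [eq_top_iff]
    calc (⊤ : Y.Opens) = Y.basicOpen (1 : Γ(Y, ⊤)) :=
          (Scheme.basicOpen_of_isUnit _ isUnit_one).symm
      _ = Y.basicOpen (e + (1 - e)) := by congr 1; ring
      _ ≤ _ := Scheme.basicOpen_add_le Y _ _
  have hinf : Y.basicOpen e ⊓ Y.basicOpen (1 - e) = ⊥ := by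
    rw [← Scheme.basicOpen_mul, mul_sub, mul_one, he, sub_self, Scheme.basicOpen_zero]
  have hcompl : ((Y.basicOpen e : Set Y))ᶜ = (Y.basicOpen (1 - e) : Set Y) := by
    have h : IsCompl (Y.basicOpen e : Set Y) (Y.basicOpen (1 - e) : Set Y) := by
      refine IsCompl.of_eq ?_ ?_
      · exact congrArg (fun U : Y.Opens => (U : Set Y)) hinf
      · exact congrArg (fun U : Y.Opens => (U : Set Y)) hsup
    exact h.compl_eq
  have hclopen : IsClopen (Y.basicOpen e : Set Y) :=
    ⟨⟨by rw [hcompl]; exact (Y.basicOpen (1 - e)).2⟩, (Y.basicOpen e).2⟩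
  have key : ∀ s : Γ(Y, ⊤), Y.basicOpen s = ⊤ → IsUnit s := fun s hs => by
    refine RingedSpace.isUnit_of_isUnit_germ Y.toRingedSpace ⊤ s fun x hx => ?_
    exact (Scheme.mem_basicOpen Y s x hx).mp (by rw [hs]; exact hx)
  rcases isClopen_iff.mp hclopen with h | h
  · left
    have h0 : Y.basicOpen e = ⊥ := TopologicalSpace.Opens.ext h
    rw [h0, bot_sup_eq] at hsup
    have hu := key _ hsup
    exact hu.mul_left_eq_zero.mp (by rw [mul_sub, mul_one, he, sub_self])
  · right
    have hu := key e (TopologicalSpace.Opens.ext h)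
    exact hu.mul_left_cancel (by rw [he, mul_one])

lemma aux_field (k A : Type u) [Field k] [CommRing A] [Nontrivial A] [Algebra k A] [IsReduced A]
    [Algebra.IsIntegral k A] (H : ∀ e : A, e * e = e → e = 0 ∨ e = 1) : IsField A := by
  refine ⟨exists_pair_ne A, mul_comm, fun {s} hs => ?_⟩
  have hp := Algebra.IsIntegral.isIntegral (R := k) s
  obtain ⟨q, hq, hnd⟩ := Polynomial.exists_eq_pow_rootMultiplicity_mul_and_not_dvd
    (minpoly k s) (minpoly.ne_zero hp) 0
  set m := (minpoly k s).rootMultiplicity 0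
  rw [Polynomial.C_0, sub_zero] at hq hnd
  have hcop : IsCoprime (Polynomial.X ^ m) q :=
    ((Polynomial.irreducible_X.coprime_iff_not_dvd).mpr hnd).pow_left
  obtain ⟨a, b, hab⟩ := hcop
  have h1 := congrArg (Polynomial.aeval s) hab
  have h2 := congrArg (Polynomial.aeval s) hq
  simp only [map_add, map_mul, map_pow, Polynomial.aeval_X, map_one, minpoly.aeval] at h1 h2
  set a' := Polynomial.aeval s a
  set b' := Polynomial.aeval s b
  set q' := Polynomial.aeval s q
  rcases H (a' * s ^ m) (by linear_combination (a' * s ^ m) * h1 + a' * b' * h2) with h | h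
  · exfalso
    apply hs
    have : s ^ m = 0 := by
      linear_combination (-s ^ m) * h1 + s ^ m * h - b' * h2
    exact eq_zero_of_pow_eq_zero this
  · obtain ⟨c, d, hcd⟩ := (Polynomial.irreducible_X.coprime_iff_not_dvd).mpr hnd
    have h3 := congrArg (Polynomial.aeval s) hcd
    simp only [map_add, map_mul, Polynomial.aeval_X, map_one] at h3
    have hq0 : q' = 0 := by linear_combination (-q') * h - a' * h2
    refine ⟨Polynomial.aeval s c, ?_⟩
    linear_combination h3 - (Polynomial.aeval s d) * hq0

set_option synthInstance.maxHeartbeats 400000 in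
set_option maxHeartbeats 1000000 in
/-- Let `k` be a field and `Y` a scheme that is proper over `Spec k`
(separated, of finite type and universally closed), reduced and connected.  Then the ring of
global sections `H⁰(Y, O_Y)`, viewed as a `k`-algebra via the structure morphism, is a field
and a finite-dimensional `k`-vector space, i.e. a finite field extension of `k`. -/
theorem global_sections_of_proper_reduced_connected_is_finite_field_extension
    (k : Type u) [Field k] (Y : Scheme.{u})
    (f : Y ⟶ Spec (CommRingCat.of k))
    [IsProper f] [IsReduced Y] [ConnectedSpace Y] :
    letI φ : CommRingCat.of k ⟶ Γ(Y, ⊤) :=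
      (Scheme.ΓSpecIso (CommRingCat.of k)).inv ≫ f.appTop
    letI : Algebra k Γ(Y, ⊤) := RingHom.toAlgebra φ.hom
    IsField Γ(Y, ⊤) ∧ FiniteDimensional k Γ(Y, ⊤) := by
  let φ : CommRingCat.of k ⟶ Γ(Y, ⊤) :=
    (Scheme.ΓSpecIso (CommRingCat.of k)).inv ≫ f.appTop
  letI : Algebra k Γ(Y, ⊤) := RingHom.toAlgebra φ.hom
  have hint : φ.hom.IsIntegral := by
    apply RingHom.isIntegral_respectsIso.2 (e := (Scheme.ΓSpecIso _).symm.commRingCatIsoToRingEquiv)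
    exact isIntegral_appTop_of_universallyClosed f
  have : Algebra.IsIntegral k Γ(Y, ⊤) := ⟨hint⟩
  have : Nonempty (⊤ : Y.Opens) := ⟨⟨Nonempty.some inferInstance, trivial⟩⟩
  have : Nontrivial Γ(Y, ⊤) := inferInstance
  have hF : IsField Γ(Y, ⊤) := aux_field k _ (aux_idem Y)
  refine ⟨hF, ?_⟩
  have x : Y := Nonempty.some inferInstance
  obtain ⟨_, ⟨U, hU, rfl⟩, hxU, -⟩ :=
    Y.isBasis_affineOpens.exists_subset_of_mem_open (Set.mem_univ x) isOpen_univ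
  have : Nonempty U := ⟨⟨x, hxU⟩⟩
  have hfin : f.appTop.hom.Finite := by
    let := ((Scheme.ΓSpecIso (.of k)).commRingCatIsoToRingEquiv.toMulEquiv.isField
      (Field.toIsField k)).toField
    let := hF.toField
    apply RingHom.finite_of_algHom_finiteType_of_isJacobsonRing (A := Γ(Y, U))
      (g := (Y.presheaf.map (homOfLE le_top).op).hom)
    exact f.finiteType_appLE (isAffineOpen_top _) hU (by simp)
  have : φ.hom.Finite := by
    apply RingHom.finite_respectsIso.2 (e := (Scheme.ΓSpecIso _).symm.commRingCatIsoToRingEquiv)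
    exact hfin
  exact this
end
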